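/- Let (V̄, Ē) be a finite oriented graph with internal vertices V, boundary vertices ∂V, edge set Ē = E ∪ ∂E, and boundary temperatures T_j > 0 for j ∈ ∂V. Let ν be a probability measure on ℝ₊^V̄ with bounded support contained in vectors with strictly positive coordinates satisfying s_j = T_j for all j ∈ ∂V, and suppose ν is invariant for the opinion model, i.e. ∫ L^O f dν = 0 for every bounded measurable f : ℝ₊^V̄ → ℝ. Then the mixture of independent exponentials μ^ζ with parameter measure ν is invariant for the boundary driven KMP generator: ∫ L^ζ g dμ^ζ = 0 for every bounded measurable g : ℝ₊^V̄ → ℝ. -/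

import Mathlib

open MeasureTheory Finset

noncomputable section

/-- Update two coordinates of a configuration. -/
def upd2 {V : Type*} [DecidableEq V] {α : Type*} (x : V → α) (i j : V) (a b : α) : V → α :=
  Function.update (Function.update x i a) j b

/-- The KMP generator with boundary conditions `T` on the graph with internal edges `Eint`
and boundary edges `Ebd`. -/
noncomputable def Lzeta {V : Type*} [Fintype V] [DecidableEq V]
    (Eint Ebd : Finset (V × V)) (T : V → ℝ)
    (g : (V → ℝ) → ℝ) (ζ : V → ℝ) : ℝ :=
  (∑ e ∈ Eint, ∫ u in (0:ℝ)..1,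
      (g (upd2 ζ e.1 e.2 (u * (ζ e.1 + ζ e.2)) ((1 - u) * (ζ e.1 + ζ e.2))) - g ζ))
  + ∑ e ∈ Ebd, ∫ u in (0:ℝ)..1, ∫ b in Set.Ioi (0:ℝ),
      Real.exp (-b) * (g (upd2 ζ e.1 e.2 (u * (ζ e.1 + ζ e.2)) (b * T e.2)) - g ζ)

/-- Generator of the opinion model on the edge set `Ebar`, with stubborn individuals at
the boundary vertices `bd`. -/
noncomputable def LO {V : Type*} [Fintype V] [DecidableEq V]
    (Ebar : Finset (V × V)) (bd : Finset V)
    (f : (V → ℝ) → ℝ) (O : V → ℝ) : ℝ :=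
  ∑ e ∈ Ebar, ∫ v in (0:ℝ)..1,
    (f (fun ℓ => if (ℓ = e.1 ∨ ℓ = e.2) ∧ ℓ ∉ bd
          then v * O e.1 + (1 - v) * O e.2 else O ℓ) - f O)

/-- The exponential distribution of mean `s`, as a measure on `ℝ`. -/
noncomputable def expMean (s : ℝ) : Measure ℝ :=
  (volume.restrict (Set.Ioi 0)).withDensity fun x => ENNReal.ofReal (s⁻¹ * Real.exp (-x / s))

/-- The mixture of independent exponentials with parameter measure `ν`. -/
noncomputable def mixExp {V : Type*} [Fintype V] (ν : Measure (V → ℝ)) : Measure (V → ℝ) :=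
  ν.bind fun s => Measure.pi fun i => expMean (s i)

/-- Uniform measure on the unit interval. -/
def unifU : Measure ℝ := volume.restrict (Set.Ioc 0 1)

instance unifU_prob : IsProbabilityMeasure unifU := ⟨by simp [unifU]⟩

lemma lint_scale (c : ℝ) (hc : 0 < c) (s : Set ℝ) (hs : MeasurableSet s) (g : ℝ → ENNReal) :
    ∫⁻ x in (fun x => c * x) '' s, g x = ∫⁻ x in s, ENNReal.ofReal c * g (c * x) := by
  have := lintegral_image_eq_lintegral_abs_deriv_mul (f := fun x => c * x) (f' := fun _ => c) hs
    (fun x _ => by simpa using ((hasDerivAt_id x).const_mul c).hasDerivWithinAt)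
    (fun x _ y _ h => by simpa [hc.ne'] using h) g
  rw [this, abs_of_pos hc]

lemma lint_shift (a : ℝ) (g : ℝ → ENNReal) :
    ∫⁻ x in Set.Ioi 0, g x = ∫⁻ x in Set.Ioi a, g (x - a) := by
  have := lintegral_image_eq_lintegral_abs_deriv_mul (s := Set.Ioi a) (f := fun x => x - a)
    (f' := fun _ => 1) measurableSet_Ioi
    (fun x _ => by simpa using ((hasDerivAt_id x).sub_const a).hasDerivWithinAt)
    (fun x _ y _ h => by simpa using h) g
  simpa using this

lemma lint_expMean (s : ℝ) (h : ℝ → ENNReal) (hh : Measurable h) :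
    ∫⁻ x, h x ∂(expMean s)
      = ∫⁻ x in Set.Ioi 0, ENNReal.ofReal (s⁻¹ * Real.exp (-x / s)) * h x := by
  rw [expMean, lintegral_withDensity_eq_lintegral_mul _ (by fun_prop) hh]
  rfl

lemma lint_exp1 (h : ℝ → ENNReal) (hh : Measurable h) :
    ∫⁻ x, h x ∂(expMean 1) = ∫⁻ x in Set.Ioi 0, ENNReal.ofReal (Real.exp (-x)) * h x := by
  simpa using lint_expMean 1 h hh

instance exp1_prob : IsProbabilityMeasure (expMean 1) := ⟨by
  rw [← lintegral_one, lint_exp1 _ measurable_const]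
  simp only [mul_one]
  rw [← ofReal_integral_eq_lintegral_ofReal, integral_exp_neg_Ioi]
  · simp
  · exact integrableOn_exp_neg_Ioi 0
  · exact Filter.Eventually.of_forall fun x => (Real.exp_pos _).le⟩

lemma expMean_eq_map (s : ℝ) (hs : 0 < s) :
    expMean s = (expMean 1).map (fun x => s * x) := by
  refine Measure.ext_of_lintegral _ fun f hf => ?_
  rw [lintegral_map hf (by fun_prop), lint_exp1 _ (by fun_prop), lint_expMean _ _ hf]
  have him : (fun x => s * x) '' Set.Ioi 0 = Set.Ioi (0:ℝ) := by
    rw [Set.image_mul_left_Ioi hs]; simp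
  conv_lhs => rw [← him]
  rw [lint_scale s hs _ measurableSet_Ioi]
  refine lintegral_congr fun x => ?_
  rw [← mul_assoc, ← ENNReal.ofReal_mul hs.le]
  congr 2
  field_simp

/-- The Gamma(2) law. -/
def gam2 : Measure ℝ :=
  (volume.restrict (Set.Ioi 0)).withDensity fun x => ENNReal.ofReal (x * Real.exp (-x))

instance gam2_sf : SFinite gam2 := by unfold gam2; infer_instance

lemma polar (φ : ℝ × ℝ → ENNReal) (hφ : Measurable φ) :
    ∫⁻ a, ∫⁻ b, φ (a, b) ∂(expMean 1) ∂(expMean 1)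
      = ∫⁻ γ, ∫⁻ u, φ (u * γ, (1 - u) * γ) ∂unifU ∂gam2 := by
  have m1 : Measurable fun a => ∫⁻ b, φ (a, b) ∂(expMean 1) := hφ.lintegral_prod_right'
  have m2 : Measurable fun γ => ∫⁻ u, φ (u * γ, (1 - u) * γ) ∂unifU :=
    Measurable.lintegral_prod_right' (f := fun p : ℝ × ℝ => φ (p.2 * p.1, (1 - p.2) * p.1))
      (by fun_prop)
  rw [lint_exp1 _ m1, gam2, lintegral_withDensity_eq_lintegral_mul _ (by fun_prop) m2]
  let F : ℝ → ℝ → ENNReal := fun a γ =>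
    Set.indicator {p : ℝ × ℝ | 0 < p.1 ∧ p.1 < p.2}
      (fun p => ENNReal.ofReal (Real.exp (-p.2)) * φ (p.1, p.2 - p.1)) (a, γ)
  have hS : MeasurableSet {p : ℝ × ℝ | 0 < p.1 ∧ p.1 < p.2} :=
    (measurableSet_lt measurable_const measurable_fst).inter
      (measurableSet_lt measurable_fst measurable_snd)
  have hF : Measurable (Function.uncurry F) :=
    Measurable.indicator (by fun_prop) hS
  have L : ∫⁻ a in Set.Ioi 0, ENNReal.ofReal (Real.exp (-a)) * ∫⁻ b, φ (a, b) ∂(expMean 1)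
      = ∫⁻ a, ∫⁻ γ, F a γ := by
    rw [← lintegral_indicator measurableSet_Ioi]
    refine lintegral_congr fun a => ?_
    by_cases ha : 0 < a
    · rw [Set.indicator_of_mem (by exact ha), lint_exp1 _ (by fun_prop), lint_shift a,
        ← lintegral_const_mul _ (by fun_prop), ← lintegral_indicator measurableSet_Ioi]
      refine lintegral_congr fun γ => ?_
      by_cases h : a < γ
      · rw [Set.indicator_of_mem (by exact h)]
        simp only [F]
        rw [Set.indicator_of_mem (by exact ⟨ha, h⟩), ← mul_assoc,
          ← ENNReal.ofReal_mul (Real.exp_pos _).le, ← Real.exp_add]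
        congr 3
        ring
      · rw [Set.indicator_of_notMem (by exact h)]
        simp only [F]
        rw [Set.indicator_of_notMem (by rintro ⟨_, h2⟩; exact h h2)]
    · rw [Set.indicator_of_notMem (by exact ha)]
      symm
      rw [lintegral_eq_zero_iff' (by fun_prop)]
      refine Filter.Eventually.of_forall fun γ => ?_
      simp only [F]
      rw [Set.indicator_of_notMem (by rintro ⟨h1, h2⟩; exact ha h1)]
      rfl
  rw [L, lintegral_lintegral_swap hF.aemeasurable, ← lintegral_indicator measurableSet_Ioi]
  refine lintegral_congr fun γ => ?_
  by_cases hγ : 0 < γ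
  · rw [Set.indicator_of_mem (by exact hγ)]
    have e1 : ∫⁻ a, F a γ = ∫⁻ a in Set.Ioo 0 γ,
        ENNReal.ofReal (Real.exp (-γ)) * φ (a, γ - a) := by
      rw [← lintegral_indicator measurableSet_Ioo]
      refine lintegral_congr fun a => ?_
      simp only [F, Set.indicator, Set.mem_ofPred_eq, Set.mem_Ioo]
    have him : (fun x => γ * x) '' Set.Ioo 0 1 = Set.Ioo (0:ℝ) γ := by
      rw [Set.image_mul_left_Ioo hγ]; simp
    rw [e1, ← him, lint_scale γ hγ _ measurableSet_Ioo, Pi.mul_apply, unifU,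
      ← lintegral_const_mul _ (by fun_prop), restrict_Ioo_eq_restrict_Ioc]
    refine lintegral_congr fun u => ?_
    rw [← mul_assoc, ← ENNReal.ofReal_mul hγ.le]
    congr 2
    ext <;> simp <;> ring
  · rw [Set.indicator_of_notMem (by exact hγ), lintegral_eq_zero_iff' (by fun_prop)]
    refine Filter.Eventually.of_forall fun a => ?_
    simp only [F]
    rw [Set.indicator_of_notMem (by rintro ⟨h1, h2⟩; exact hγ (h1.trans h2))]
    rfl

lemma key (p q : ℝ) (φ : ℝ × ℝ → ENNReal) (hφ : Measurable φ) :
    ∫⁻ a, ∫⁻ b, ∫⁻ u, φ (u * (p * a + q * b), (1 - u) * (p * a + q * b))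
        ∂unifU ∂(expMean 1) ∂(expMean 1)
      = ∫⁻ v, ∫⁻ a, ∫⁻ b, φ ((v * p + (1 - v) * q) * a, (v * p + (1 - v) * q) * b)
        ∂(expMean 1) ∂(expMean 1) ∂unifU := by
  rw [polar (fun x => ∫⁻ u, φ (u * (p * x.1 + q * x.2), (1 - u) * (p * x.1 + q * x.2)) ∂unifU)
    (Measurable.lintegral_prod_right'
      (f := fun z : (ℝ × ℝ) × ℝ => φ (z.2 * (p * z.1.1 + q * z.1.2),
        (1 - z.2) * (p * z.1.1 + q * z.1.2))) (by fun_prop))]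
  have h : ∀ v : ℝ, ∫⁻ a, ∫⁻ b, φ ((v * p + (1 - v) * q) * a, (v * p + (1 - v) * q) * b)
        ∂(expMean 1) ∂(expMean 1)
      = ∫⁻ γ, ∫⁻ u, φ ((v * p + (1 - v) * q) * (u * γ), (v * p + (1 - v) * q) * ((1 - u) * γ))
          ∂unifU ∂gam2 := fun v =>
    polar (fun x => φ ((v * p + (1 - v) * q) * x.1, (v * p + (1 - v) * q) * x.2)) (by fun_prop)
  simp_rw [h]
  rw [lintegral_lintegral_swap (μ := unifU)]
  · refine lintegral_congr fun γ => lintegral_congr fun v => lintegral_congr fun u => ?_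
    congr 1
    ext <;> simp <;> ring
  · refine Measurable.aemeasurable ?_
    exact Measurable.lintegral_prod_right'
      (f := fun z : (ℝ × ℝ) × ℝ => φ ((z.1.1 * p + (1 - z.1.1) * q) * (z.2 * z.1.2),
        (z.1.1 * p + (1 - z.1.1) * q) * ((1 - z.2) * z.1.2))) (by fun_prop)

section graph
variable {V : Type*} [Fintype V] [DecidableEq V]

/-- Product of standard exponentials. -/
def expP (V : Type*) [Fintype V] : Measure (V → ℝ) := Measure.pi fun _ => expMean 1

instance expP_prob : IsProbabilityMeasure (expP V) := by unfold expP; infer_instance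

lemma resample1 (i : V) :
    ((expP V).prod (expMean 1)).map (fun p => Function.update p.1 i p.2) = expP V := by
  symm
  refine Measure.pi_eq fun s hs => ?_
  rw [Measure.map_apply measurable_update' (MeasurableSet.univ_pi hs)]
  have : (fun p : (V → ℝ) × ℝ => Function.update p.1 i p.2) ⁻¹' (Set.univ.pi s)
      = (Set.univ.pi (Function.update s i Set.univ)) ×ˢ (s i) := by
    ext ⟨x, a⟩
    simp only [Set.mem_preimage, Set.mem_pi, Set.mem_univ, true_implies, Set.mem_prod]
    constructor
    · intro h
      refine ⟨fun k => ?_, by simpa using h i⟩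
      by_cases hk : k = i
      · subst hk; simp
      · simpa [hk] using h k
    · rintro ⟨h, ha⟩ k
      by_cases hk : k = i
      · subst hk; simpa using ha
      · simpa [hk] using h k
  rw [this, Measure.prod_prod, expP, Measure.pi_pi,
    ← Finset.mul_prod_erase _ _ (Finset.mem_univ i),
    ← Finset.mul_prod_erase (s := Finset.univ) _ (Finset.mem_univ i)]
  simp only [Function.update_self, measure_univ, one_mul]
  rw [mul_comm]
  congr 1
  refine Finset.prod_congr rfl fun k hk => ?_
  rw [Function.update_of_ne (Finset.ne_of_mem_erase hk)]

lemma lint_resample1 (i : V) (φ : (V → ℝ) → ENNReal) (hφ : Measurable φ) :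
    ∫⁻ x, φ x ∂(expP V) = ∫⁻ x, ∫⁻ a, φ (Function.update x i a) ∂(expMean 1) ∂(expP V) := by
  conv_lhs => rw [← resample1 i]
  rw [lintegral_map hφ measurable_update',
    lintegral_prod (fun p : (V → ℝ) × ℝ => φ (Function.update p.1 i p.2))
    (hφ.comp measurable_update').aemeasurable]

@[fun_prop]
lemma meas_upd2 {Ω : Type*} [MeasurableSpace Ω] (i j : V) (x : Ω → V → ℝ) (a b : Ω → ℝ)
    (hx : Measurable x) (ha : Measurable a) (hb : Measurable b) :
    Measurable fun ω => upd2 (x ω) i j (a ω) (b ω) := by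
  unfold upd2
  exact measurable_update'.comp ((measurable_update'.comp (hx.prodMk ha)).prodMk hb)

lemma lint_resample (i j : V) (φ : (V → ℝ) → ENNReal) (hφ : Measurable φ) :
    ∫⁻ x, φ x ∂(expP V)
      = ∫⁻ x, ∫⁻ a, ∫⁻ b, φ (upd2 x i j a b) ∂(expMean 1) ∂(expMean 1) ∂(expP V) := by
  rw [lint_resample1 j φ hφ, lint_resample1 i]
  · rfl
  · exact Measurable.lintegral_prod_right' (f := fun p : (V → ℝ) × ℝ => φ (Function.update p.1 j p.2))
      (hφ.comp measurable_update')

/-- Opinion update. -/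
def opU (bd : Finset V) (i j : V) (s : V → ℝ) (v : ℝ) : V → ℝ :=
  fun ℓ => if (ℓ = i ∨ ℓ = j) ∧ ℓ ∉ bd then v * s i + (1 - v) * s j else s ℓ

@[fun_prop]
lemma meas_opU {Ω : Type*} [MeasurableSpace Ω] (bd : Finset V) (i j : V) (s : Ω → V → ℝ) (v : Ω → ℝ)
    (hs : Measurable s) (hv : Measurable v) : Measurable fun ω => opU bd i j (s ω) (v ω) := by
  refine measurable_pi_iff.2 fun ℓ => ?_
  unfold opU
  split_ifs <;> fun_prop

lemma edge_int (bd : Finset V) (i j : V) (hi : i ∉ bd) (hj : j ∉ bd) (hij : i ≠ j) (s : V → ℝ)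
    (φ : (V → ℝ) → ENNReal) (hφ : Measurable φ) :
    ∫⁻ x, ∫⁻ u, φ (upd2 (fun k => s k * x k) i j (u * (s i * x i + s j * x j))
        ((1 - u) * (s i * x i + s j * x j))) ∂unifU ∂(expP V)
      = ∫⁻ v, ∫⁻ x, φ (fun k => opU bd i j s v k * x k) ∂(expP V) ∂unifU := by
  have hm : Measurable fun x : V → ℝ => ∫⁻ u, φ (upd2 (fun k => s k * x k) i j
      (u * (s i * x i + s j * x j)) ((1 - u) * (s i * x i + s j * x j))) ∂unifU :=
    Measurable.lintegral_prod_right' (f := fun z : (V → ℝ) × ℝ => φ (upd2 (fun k => s k * z.1 k) i j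
      (z.2 * (s i * z.1 i + s j * z.1 j)) ((1 - z.2) * (s i * z.1 i + s j * z.1 j))))
      (by fun_prop)
  rw [lint_resample i j _ hm]
  have hL : ∀ (x : V → ℝ) (a b u : ℝ), upd2 (fun k => s k * upd2 x i j a b k) i j
      (u * (s i * upd2 x i j a b i + s j * upd2 x i j a b j))
      ((1 - u) * (s i * upd2 x i j a b i + s j * upd2 x i j a b j))
      = upd2 (fun k => s k * x k) i j (u * (s i * a + s j * b)) ((1 - u) * (s i * a + s j * b)) := by
    intro x a b u
    ext k
    by_cases hk : k = j
    · subst hk; simp [upd2, hij]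
    by_cases hk' : k = i
    · subst hk'; simp [upd2, hij]
    simp [upd2, hk, hk']
  have hR : ∀ (x : V → ℝ) (a b v : ℝ), (fun k => opU bd i j s v k * upd2 x i j a b k)
      = upd2 (fun k => s k * x k) i j ((v * s i + (1 - v) * s j) * a)
        ((v * s i + (1 - v) * s j) * b) := by
    intro x a b v
    ext k
    by_cases hk : k = j
    · subst hk; simp [upd2, opU, hj]
    by_cases hk' : k = i
    · subst hk'; simp [upd2, hij, opU, hi]
    simp [upd2, hk, hk', opU]
  simp_rw [hL]
  have hR2 : ∀ v : ℝ, ∫⁻ x, φ (fun k => opU bd i j s v k * x k) ∂(expP V)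
      = ∫⁻ x, ∫⁻ a, ∫⁻ b, φ (upd2 (fun k => s k * x k) i j ((v * s i + (1 - v) * s j) * a)
        ((v * s i + (1 - v) * s j) * b)) ∂(expMean 1) ∂(expMean 1) ∂(expP V) := by
    intro v
    rw [lint_resample i j _ (by fun_prop)]
    simp_rw [hR]
  simp_rw [hR2]
  rw [lintegral_lintegral_swap (μ := unifU)]
  · refine lintegral_congr fun x => ?_
    exact key (s i) (s j) (fun p => φ (upd2 (fun k => s k * x k) i j p.1 p.2)) (by fun_prop)
  · refine Measurable.aemeasurable ?_
    refine Measurable.lintegral_prod_right' (f := fun z : (ℝ × (V → ℝ)) × ℝ =>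
      ∫⁻ b, φ (upd2 (fun k => s k * z.1.2 k) i j ((z.1.1 * s i + (1 - z.1.1) * s j) * z.2)
        ((z.1.1 * s i + (1 - z.1.1) * s j) * b)) ∂(expMean 1)) ?_
    exact Measurable.lintegral_prod_right' (f := fun z : ((ℝ × (V → ℝ)) × ℝ) × ℝ =>
      φ (upd2 (fun k => s k * z.1.1.2 k) i j ((z.1.1.1 * s i + (1 - z.1.1.1) * s j) * z.1.2)
        ((z.1.1.1 * s i + (1 - z.1.1.1) * s j) * z.2))) (by fun_prop)

lemma edge_bd (bd : Finset V) (i j : V) (hi : i ∉ bd) (hj : j ∈ bd) (s : V → ℝ)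
    (t : ℝ) (ht : s j = t) (φ : (V → ℝ) → ENNReal) (hφ : Measurable φ) :
    ∫⁻ x, ∫⁻ u, ∫⁻ b, φ (upd2 (fun k => s k * x k) i j (u * (s i * x i + s j * x j))
        (b * t)) ∂(expMean 1) ∂unifU ∂(expP V)
      = ∫⁻ v, ∫⁻ x, φ (fun k => opU bd i j s v k * x k) ∂(expP V) ∂unifU := by
  have hij : i ≠ j := fun h => hi (h ▸ hj)
  have hm : Measurable fun x : V → ℝ => ∫⁻ u, ∫⁻ b, φ (upd2 (fun k => s k * x k) i j
      (u * (s i * x i + s j * x j)) (b * t)) ∂(expMean 1) ∂unifU := by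
    refine Measurable.lintegral_prod_right' (f := fun z : (V → ℝ) × ℝ =>
      ∫⁻ b, φ (upd2 (fun k => s k * z.1 k) i j
      (z.2 * (s i * z.1 i + s j * z.1 j)) (b * t)) ∂(expMean 1)) ?_
    exact Measurable.lintegral_prod_right' (f := fun z : ((V → ℝ) × ℝ) × ℝ =>
      φ (upd2 (fun k => s k * z.1.1 k) i j
      (z.1.2 * (s i * z.1.1 i + s j * z.1.1 j)) (z.2 * t))) (by fun_prop)
  rw [lint_resample i j _ hm]
  have hL : ∀ (x : V → ℝ) (a b u c : ℝ), upd2 (fun k => s k * upd2 x i j a b k) i j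
      (u * (s i * upd2 x i j a b i + s j * upd2 x i j a b j)) c
      = upd2 (fun k => s k * x k) i j (u * (s i * a + s j * b)) c := by
    intro x a b u c
    ext k
    by_cases hk : k = j
    · subst hk; simp [upd2]
    by_cases hk' : k = i
    · subst hk'; simp [upd2, hij]
    simp [upd2, hk, hk']
  have hR : ∀ (x : V → ℝ) (a b v : ℝ), (fun k => opU bd i j s v k * upd2 x i j a b k)
      = upd2 (fun k => s k * x k) i j ((v * s i + (1 - v) * s j) * a) (b * t) := by
    intro x a b v
    ext k
    by_cases hk : k = j
    · subst hk; simp [upd2, opU, hj, ht, mul_comm]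
    by_cases hk' : k = i
    · subst hk'; simp [upd2, hij, opU, hi]
    simp [upd2, hk, hk', opU]
  simp_rw [hL]
  have hR2 : ∀ v : ℝ, ∫⁻ x, φ (fun k => opU bd i j s v k * x k) ∂(expP V)
      = ∫⁻ x, ∫⁻ a, ∫⁻ b, φ (upd2 (fun k => s k * x k) i j ((v * s i + (1 - v) * s j) * a)
        (b * t)) ∂(expMean 1) ∂(expMean 1) ∂(expP V) := by
    intro v
    rw [lint_resample i j _ (by fun_prop)]
    simp_rw [hR]
  simp_rw [hR2]
  rw [lintegral_lintegral_swap (μ := unifU)]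
  · refine lintegral_congr fun x => ?_
    have := key (s i) (s j) (fun p => ∫⁻ b, φ (upd2 (fun k => s k * x k) i j p.1 (b * t))
      ∂(expMean 1)) (Measurable.lintegral_prod_right' (f := fun z : (ℝ × ℝ) × ℝ =>
        φ (upd2 (fun k => s k * x k) i j z.1.1 (z.2 * t))) (by fun_prop))
    rw [this]
    simp
  · refine Measurable.aemeasurable ?_
    refine Measurable.lintegral_prod_right' (f := fun z : (ℝ × (V → ℝ)) × ℝ =>
      ∫⁻ b, φ (upd2 (fun k => s k * z.1.2 k) i j ((z.1.1 * s i + (1 - z.1.1) * s j) * z.2)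
        (b * t)) ∂(expMean 1)) ?_
    exact Measurable.lintegral_prod_right' (f := fun z : ((ℝ × (V → ℝ)) × ℝ) × ℝ =>
      φ (upd2 (fun k => s k * z.1.1.2 k) i j ((z.1.1.1 * s i + (1 - z.1.1.1) * s j) * z.1.2)
        (z.2 * t))) (by fun_prop)

lemma mix_eq (ν : Measure (V → ℝ)) [IsProbabilityMeasure ν] (h : ∀ᵐ s ∂ν, ∀ i, 0 < s i) :
    mixExp ν = (ν.prod (expP V)).map (fun p k => p.1 k * p.2 k) := by
  have hm : Measurable fun p : (V → ℝ) × (V → ℝ) => fun k => p.1 k * p.2 k := by fun_prop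
  have e : (fun s : V → ℝ => Measure.pi fun i => expMean (s i)) =ᵐ[ν]
      fun s => ((expP V).map (Prod.mk s)).map (fun p k => p.1 k * p.2 k) := by
    filter_upwards [h] with s hs
    rw [Measure.map_map hm (by fun_prop)]
    have : ∀ i, expMean (s i) = (expMean 1).map (fun x => s i * x) :=
      fun i => expMean_eq_map _ (hs i)
    simp_rw [this]
    have : ∀ i, IsProbabilityMeasure ((expMean 1).map (fun x => s i * x)) :=
      fun i => Measure.isProbabilityMeasure_map (by fun_prop)
    rw [← Measure.pi_map_pi (fun i => by fun_prop)]
    rfl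
  have hk : Measurable fun s : V → ℝ => ((expP V).map (Prod.mk s)).map
      (fun p : (V → ℝ) × (V → ℝ) => fun k => p.1 k * p.2 k) :=
    (Measure.measurable_map _ hm).comp Measurable.map_prodMk_left
  rw [mixExp, Measure.bind_congr_right e]
  refine Measure.ext_of_lintegral _ fun f hf => ?_
  rw [Measure.lintegral_bind hk.aemeasurable hf.aemeasurable, lintegral_map hf hm,
    lintegral_prod (fun p : (V → ℝ) × (V → ℝ) => f fun k => p.1 k * p.2 k)
      (hf.comp hm).aemeasurable]
  refine lintegral_congr fun s => ?_
  rw [lintegral_map hf hm, lintegral_map (f := fun p : (V → ℝ) × (V → ℝ) => f fun k => p.1 k * p.2 k)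
    (hf.comp hm) (by fun_prop)]

end graph

lemma int_bdd {X Z : Type*} [MeasurableSpace X] [MeasurableSpace Z] (μ : Measure X)
    [IsFiniteMeasure μ] (Φ : X → Z) (hΦ : Measurable Φ) (g : Z → ℝ) (hg : Measurable g)
    (hb : ∃ C, ∀ x, |g x| ≤ C) : Integrable (fun x => g (Φ x)) μ := by
  obtain ⟨C, hC⟩ := hb
  exact Integrable.of_bound (hg.comp hΦ).aestronglyMeasurable C
    (Filter.Eventually.of_forall fun x => hC _)

lemma transfer {X Y X' Y' Z : Type*} [MeasurableSpace X] [MeasurableSpace Y]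
    [MeasurableSpace X'] [MeasurableSpace Y'] [MeasurableSpace Z]
    (μ : Measure X) (κ : Measure Y) (μ' : Measure X') (κ' : Measure Y')
    [IsFiniteMeasure μ] [IsFiniteMeasure κ] [IsFiniteMeasure μ'] [IsFiniteMeasure κ']
    (Φ : X × Y → Z) (Φ' : X' × Y' → Z) (hΦ : Measurable Φ) (hΦ' : Measurable Φ')
    (H : ∀ φ : Z → ENNReal, Measurable φ →
      ∫⁻ x, ∫⁻ y, φ (Φ (x, y)) ∂κ ∂μ = ∫⁻ x, ∫⁻ y, φ (Φ' (x, y)) ∂κ' ∂μ')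
    (g : Z → ℝ) (hg : Measurable g) (hb : ∃ C, ∀ x, |g x| ≤ C) :
    ∫ x, ∫ y, g (Φ (x, y)) ∂κ ∂μ = ∫ x, ∫ y, g (Φ' (x, y)) ∂κ' ∂μ' := by
  rw [← integral_prod (fun z => g (Φ z)) (int_bdd _ Φ hΦ g hg hb),
    ← integral_prod (fun z => g (Φ' z)) (int_bdd _ Φ' hΦ' g hg hb),
    ← integral_map hΦ.aemeasurable hg.aestronglyMeasurable,
    ← integral_map hΦ'.aemeasurable hg.aestronglyMeasurable]
  congr 1
  refine Measure.ext_of_lintegral _ fun φ hφ => ?_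
  rw [lintegral_map hφ hΦ, lintegral_map hφ hΦ', lintegral_prod (fun z => φ (Φ z)) (hφ.comp hΦ).aemeasurable,
    lintegral_prod (fun z => φ (Φ' z)) (hφ.comp hΦ').aemeasurable]
  exact H φ hφ

lemma integrable_sub_fun {X : Type*} [MeasurableSpace X] {μ : Measure X} {F h : X → ℝ}
    (hF : Integrable F μ) (hh : Integrable h μ) : Integrable (fun s => F s - h s) μ :=
  hF.sub hh

lemma int_sum_sub {X ι : Type*} [MeasurableSpace X] (μ : Measure X) (S : Finset ι)
    (F : ι → X → ℝ) (h : X → ℝ) (hF : ∀ e, Integrable (F e) μ) (hh : Integrable h μ) :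
    ∫ s, ∑ e ∈ S, (F e s - h s) ∂μ = ∑ e ∈ S, (∫ s, F e s ∂μ - ∫ s, h s ∂μ) := by
  rw [integral_finsetSum S (f := fun e s => F e s - h s) (fun e _ => (hF e).sub hh)]
  exact Finset.sum_congr rfl fun e _ => integral_sub (hF e) hh

/-- if `ν` is invariant for the opinion model, then the mixture of independent
exponentials with parameter measure `ν` is invariant for the boundary driven KMP process. -/
theorem mixture_invariant_for_KMP
    {V : Type*} [Fintype V] [DecidableEq V]
    (bd : Finset V) (Eint Ebd : Finset (V × V)) (T : V → ℝ)
    (hE : ∀ e ∈ Eint, e.1 ∉ bd ∧ e.2 ∉ bd ∧ e.1 ≠ e.2)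
    (hEb : ∀ e ∈ Ebd, e.1 ∉ bd ∧ e.2 ∈ bd)
    (hT : ∀ j ∈ bd, 0 < T j)
    (ν : Measure (V → ℝ)) [IsProbabilityMeasure ν] (R : ℝ)
    (hsupp : ∀ᵐ s ∂ν, ∀ i, 0 < s i ∧ s i ≤ R)
    (hsbd : ∀ᵐ s ∂ν, ∀ j ∈ bd, s j = T j)
    (hinv : ∀ f : (V → ℝ) → ℝ, Measurable f → (∃ C, ∀ x, |f x| ≤ C) →
        ∫ O, LO (Eint ∪ Ebd) bd f O ∂ν = 0)
    (g : (V → ℝ) → ℝ) (hgm : Measurable g) (hgb : ∃ C, ∀ x, |g x| ≤ C) :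
    ∫ ζ, Lzeta Eint Ebd T g ζ ∂(mixExp ν) = 0 := by
  have hpos : ∀ᵐ s ∂ν, ∀ i, 0 < s i := hsupp.mono fun s h i => (h i).1
  have hmix := mix_eq ν hpos
  have hmul : Measurable fun p : (V → ℝ) × (V → ℝ) => fun k => p.1 k * p.2 k := by fun_prop
  have hprob : IsProbabilityMeasure (mixExp ν) := by
    rw [hmix]; exact Measure.isProbabilityMeasure_map hmul.aemeasurable
  let f : (V → ℝ) → ℝ := fun s => ∫ x, g (fun k => s k * x k) ∂(expP V)
  have hfm : Measurable f :=
    (StronglyMeasurable.integral_prod_right' (f := fun p : (V → ℝ) × (V → ℝ) =>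
      g (fun k => p.1 k * p.2 k)) (hgm.comp hmul).stronglyMeasurable).measurable
  have hfb : ∃ C, ∀ x, |f x| ≤ C := by
    obtain ⟨C, hC⟩ := hgb
    refine ⟨C, fun s => ?_⟩
    have := norm_integral_le_of_norm_le_const (μ := expP V)
      (f := fun x => g (fun k => s k * x k)) (C := C) (Filter.Eventually.of_forall fun x => hC _)
    simpa using this
  have hmixlint : ∀ φ : (V → ℝ) → ENNReal, Measurable φ →
      ∫⁻ ζ, φ ζ ∂(mixExp ν) = ∫⁻ s, ∫⁻ x, φ (fun k => s k * x k) ∂(expP V) ∂ν := by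
    intro φ hφ
    rw [hmix, lintegral_map hφ hmul,
      lintegral_prod (fun p : (V → ℝ) × (V → ℝ) => φ fun k => p.1 k * p.2 k)
        (hφ.comp hmul).aemeasurable]
  have hg0 : ∫ ζ, g ζ ∂(mixExp ν) = ∫ s, f s ∂ν := by
    rw [hmix, integral_map hmul.aemeasurable hgm.aestronglyMeasurable]
    exact integral_prod (fun p : (V → ℝ) × (V → ℝ) => g fun k => p.1 k * p.2 k)
      (int_bdd _ _ hmul g hgm hgb)
  have hgi : Integrable g (mixExp ν) := int_bdd _ id measurable_id g hgm hgb
  have hfi : Integrable f ν := int_bdd _ id measurable_id f hfm hfb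
  -- the opinion side
  have hO : ∀ i j : V, ∫ s, ∫ v, f (opU bd i j s v) ∂unifU ∂ν
      = ∫ s, ∫ y : ℝ × (V → ℝ), g (fun k => opU bd i j s y.1 k * y.2 k)
        ∂(unifU.prod (expP V)) ∂ν := by
    intro i j
    refine integral_congr_ae (Filter.Eventually.of_forall fun s => ?_)
    exact (integral_prod (fun y : ℝ × (V → ℝ) => g (fun k => opU bd i j s y.1 k * y.2 k))
      (int_bdd _ _ (by fun_prop) g hgm hgb)).symm
  have hOl : ∀ (i j : V) (s : V → ℝ) (φ : (V → ℝ) → ENNReal), Measurable φ →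
      ∫⁻ v, ∫⁻ x, φ (fun k => opU bd i j s v k * x k) ∂(expP V) ∂unifU
      = ∫⁻ y : ℝ × (V → ℝ), φ (fun k => opU bd i j s y.1 k * y.2 k)
        ∂(unifU.prod (expP V)) := by
    intro i j s φ hφ
    exact (lintegral_prod (fun y : ℝ × (V → ℝ) => φ (fun k => opU bd i j s y.1 k * y.2 k))
      (Measurable.aemeasurable (by fun_prop))).symm
  have hA : ∀ e ∈ Eint, ∫ ζ, ∫ u, g (upd2 ζ e.1 e.2 (u * (ζ e.1 + ζ e.2))
      ((1 - u) * (ζ e.1 + ζ e.2))) ∂unifU ∂(mixExp ν)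
      = ∫ s, ∫ v, f (opU bd e.1 e.2 s v) ∂unifU ∂ν := by
    intro e he
    obtain ⟨h1, h2, h3⟩ := hE e he
    rw [hO]
    refine transfer (mixExp ν) unifU ν (unifU.prod (expP V))
      (fun z : (V → ℝ) × ℝ => upd2 z.1 e.1 e.2 (z.2 * (z.1 e.1 + z.1 e.2))
        ((1 - z.2) * (z.1 e.1 + z.1 e.2)))
      (fun z : (V → ℝ) × (ℝ × (V → ℝ)) => fun k => opU bd e.1 e.2 z.1 z.2.1 k * z.2.2 k)
      (by fun_prop) (by fun_prop) ?_ g hgm hgb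
    intro φ hφ
    rw [hmixlint _ (Measurable.lintegral_prod_right' (f := fun z : (V → ℝ) × ℝ =>
      φ (upd2 z.1 e.1 e.2 (z.2 * (z.1 e.1 + z.1 e.2))
        ((1 - z.2) * (z.1 e.1 + z.1 e.2)))) (by fun_prop))]
    refine lintegral_congr fun s => ?_
    rw [← hOl _ _ _ _ hφ]
    exact edge_int bd e.1 e.2 h1 h2 h3 s φ hφ
  have hB : ∀ e ∈ Ebd, ∫ ζ, ∫ y : ℝ × ℝ, g (upd2 ζ e.1 e.2 (y.1 * (ζ e.1 + ζ e.2))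
      (y.2 * T e.2)) ∂(unifU.prod (expMean 1)) ∂(mixExp ν)
      = ∫ s, ∫ v, f (opU bd e.1 e.2 s v) ∂unifU ∂ν := by
    intro e he
    obtain ⟨h1, h2⟩ := hEb e he
    rw [hO]
    refine transfer (mixExp ν) (unifU.prod (expMean 1)) ν (unifU.prod (expP V))
      (fun z : (V → ℝ) × (ℝ × ℝ) => upd2 z.1 e.1 e.2 (z.2.1 * (z.1 e.1 + z.1 e.2))
        (z.2.2 * T e.2))
      (fun z : (V → ℝ) × (ℝ × (V → ℝ)) => fun k => opU bd e.1 e.2 z.1 z.2.1 k * z.2.2 k)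
      (by fun_prop) (by fun_prop) ?_ g hgm hgb
    intro φ hφ
    rw [hmixlint _ (Measurable.lintegral_prod_right' (f := fun z : (V → ℝ) × (ℝ × ℝ) =>
      φ (upd2 z.1 e.1 e.2 (z.2.1 * (z.1 e.1 + z.1 e.2))
        (z.2.2 * T e.2))) (by fun_prop))]
    refine lintegral_congr_ae ?_
    filter_upwards [hsbd] with s hs
    rw [← hOl _ _ _ _ hφ, ← edge_bd bd e.1 e.2 h1 h2 s (T e.2) (hs _ h2) φ hφ]
    refine lintegral_congr fun x => ?_
    exact lintegral_prod (fun y : ℝ × ℝ => φ (upd2 (fun k => s k * x k) e.1 e.2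
      (y.1 * (s e.1 * x e.1 + s e.2 * x e.2)) (y.2 * T e.2)))
      (Measurable.aemeasurable (by fun_prop))
  have hAi : ∀ e : V × V, Integrable (fun ζ : V → ℝ => ∫ u, g (upd2 ζ e.1 e.2
      (u * (ζ e.1 + ζ e.2)) ((1 - u) * (ζ e.1 + ζ e.2))) ∂unifU) (mixExp ν) := fun e =>
    Integrable.integral_prod_left (f := fun z : (V → ℝ) × ℝ => g (upd2 z.1 e.1 e.2
      (z.2 * (z.1 e.1 + z.1 e.2)) ((1 - z.2) * (z.1 e.1 + z.1 e.2))))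
      (int_bdd _ _ (by fun_prop) g hgm hgb)
  have hBi : ∀ e : V × V, Integrable (fun ζ : V → ℝ => ∫ y : ℝ × ℝ, g (upd2 ζ e.1 e.2
      (y.1 * (ζ e.1 + ζ e.2)) (y.2 * T e.2)) ∂(unifU.prod (expMean 1))) (mixExp ν) := fun e =>
    Integrable.integral_prod_left (f := fun z : (V → ℝ) × (ℝ × ℝ) => g (upd2 z.1 e.1 e.2
      (z.2.1 * (z.1 e.1 + z.1 e.2)) (z.2.2 * T e.2)))
      (int_bdd _ _ (by fun_prop) g hgm hgb)
  have hOi : ∀ e : V × V, Integrable (fun s : V → ℝ => ∫ v, f (opU bd e.1 e.2 s v) ∂unifU) ν :=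
    fun e => Integrable.integral_prod_left (f := fun z : (V → ℝ) × ℝ => f (opU bd e.1 e.2 z.1 z.2))
      (int_bdd _ _ (by fun_prop) f hfm hfb)
  -- rewriting of the generators
  have hLO : ∀ s, LO (Eint ∪ Ebd) bd f s
      = ∑ e ∈ Eint ∪ Ebd, ((∫ v, f (opU bd e.1 e.2 s v) ∂unifU) - f s) := by
    intro s
    unfold LO
    refine Finset.sum_congr rfl fun e _ => ?_
    rw [intervalIntegral.integral_of_le zero_le_one]
    change ∫ v, (f (opU bd e.1 e.2 s v) - f s) ∂unifU = _
    rw [integral_sub (int_bdd _ _ (by fun_prop) f hfm hfb) (integrable_const _)]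
    simp
  have hE1 : ∀ h : ℝ → ℝ, ∫ b in Set.Ioi (0:ℝ), Real.exp (-b) * h b = ∫ b, h b ∂(expMean 1) := by
    intro h
    rw [expMean, integral_withDensity_eq_integral_toReal_smul (by fun_prop)
      (Filter.Eventually.of_forall fun x => ENNReal.ofReal_lt_top)]
    refine integral_congr_ae (Filter.Eventually.of_forall fun b => ?_)
    simp [ENNReal.toReal_ofReal (Real.exp_pos _).le]
  have hLz : ∀ ζ, Lzeta Eint Ebd T g ζ
      = ∑ e ∈ Eint, ((∫ u, g (upd2 ζ e.1 e.2
          (u * (ζ e.1 + ζ e.2)) ((1 - u) * (ζ e.1 + ζ e.2))) ∂unifU) - g ζ)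
        + ∑ e ∈ Ebd, ((∫ y : ℝ × ℝ, g (upd2 ζ e.1 e.2
          (y.1 * (ζ e.1 + ζ e.2)) (y.2 * T e.2)) ∂(unifU.prod (expMean 1))) - g ζ) := by
    intro ζ
    unfold Lzeta
    congr 1
    · refine Finset.sum_congr rfl fun e _ => ?_
      rw [intervalIntegral.integral_of_le zero_le_one]
      change ∫ u, (g (upd2 ζ e.1 e.2 (u * (ζ e.1 + ζ e.2)) ((1 - u) * (ζ e.1 + ζ e.2))) - g ζ)
        ∂unifU = _
      rw [integral_sub (int_bdd _ _ (by fun_prop) g hgm hgb) (integrable_const _)]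
      simp
    · refine Finset.sum_congr rfl fun e _ => ?_
      rw [intervalIntegral.integral_of_le zero_le_one]
      simp_rw [hE1]
      change ∫ u, (∫ b, (g (upd2 ζ e.1 e.2 (u * (ζ e.1 + ζ e.2)) (b * T e.2)) - g ζ)
        ∂(expMean 1)) ∂unifU = _
      have hi : Integrable (fun y : ℝ × ℝ => g (upd2 ζ e.1 e.2
          (y.1 * (ζ e.1 + ζ e.2)) (y.2 * T e.2))) (unifU.prod (expMean 1)) :=
        int_bdd _ _ (by fun_prop) g hgm hgb
      rw [← integral_prod (fun y : ℝ × ℝ => g (upd2 ζ e.1 e.2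
          (y.1 * (ζ e.1 + ζ e.2)) (y.2 * T e.2)) - g ζ) (hi.sub (integrable_const _)),
        integral_sub hi (integrable_const _)]
      simp
  have hdisj : Disjoint Eint Ebd := by
    rw [Finset.disjoint_left]
    intro e h1 h2
    exact (hE e h1).2.1 (hEb e h2).2
  have hfin := hinv f hfm hfb
  simp_rw [hLO] at hfin
  rw [int_sum_sub ν _ (fun (e : V × V) s => ∫ v, f (opU bd e.1 e.2 s v) ∂unifU) f hOi hfi,
    Finset.sum_union hdisj] at hfin
  simp_rw [hLz]
  rw [integral_add (integrable_finsetSum _ fun e _ => integrable_sub_fun (hAi e) hgi)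
    (integrable_finsetSum _ fun e _ => integrable_sub_fun (hBi e) hgi),
    int_sum_sub (mixExp ν) _ (fun (e : V × V) ζ => ∫ u, g (upd2 ζ e.1 e.2
          (u * (ζ e.1 + ζ e.2)) ((1 - u) * (ζ e.1 + ζ e.2))) ∂unifU) g hAi hgi,
    int_sum_sub (mixExp ν) _ (fun (e : V × V) ζ => ∫ y : ℝ × ℝ, g (upd2 ζ e.1 e.2
          (y.1 * (ζ e.1 + ζ e.2)) (y.2 * T e.2)) ∂(unifU.prod (expMean 1))) g hBi hgi, ← hfin]
  congr 1
  · refine Finset.sum_congr rfl fun e he => ?_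
    rw [hA e he, hg0]
  · refine Finset.sum_congr rfl fun e he => ?_
    rw [hB e he, hg0]

end
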